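/- Coercivity estimate (inequality (3.12)). Suppose b₁,b₂≥0 and conditions (V), (F_0), (F_1), (F_5) hold, with μ̄>4, σ and γ_{2,i} as in (F_5). Then for every (u,v)∈E, Φ(u,v) − (1/μ̄)⟨Φ'(u,v),(u,v)⟩ ≥ ((μ̄−2)/(2μ̄) − (σ/μ̄)·max{γ_{2,1}²,γ_{2,2}²})·(‖u‖_{E₁}² + ‖v‖_{E₂}²), and the coefficient (μ̄−2)/(2μ̄) − (σ/μ̄)·max{γ_{2,1}²,γ_{2,2}²} is strictly positive. -/

import Mathlib

open Filter Topology

/-- A connected, locally finite weighted graph `G = (V, E)` with symmetric positive edge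
weights `w` (vanishing off edges) and a vertex measure `mu` with positive lower bound
`mumin`. -/
structure WeightedGraph (V : Type*) where
  G : SimpleGraph V
  connected : G.Connected
  locallyFinite : ∀ x : V, (G.neighborSet x).Finite
  w : V → V → ℝ
  w_symm : ∀ x y, w x y = w y x
  w_pos : ∀ x y, G.Adj x y → 0 < w x y
  w_eq_zero : ∀ x y, ¬ G.Adj x y → w x y = 0
  mu : V → ℝ
  mumin : ℝ
  mumin_pos : 0 < mumin
  mu_ge : ∀ x, mumin ≤ mu x

namespace WeightedGraph

variable {V : Type*} (S : WeightedGraph V)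

/-- `∫_V φ dμ = Σ_{x ∈ V} φ(x) μ(x)`. -/
noncomputable def integral (φ : V → ℝ) : ℝ := ∑' x, φ x * S.mu x

/-- The graph Laplacian `Δu(x) = (1/μ(x)) Σ_{y ∼ x} w_{xy} (u(y) - u(x))`. -/
noncomputable def lap (u : V → ℝ) (x : V) : ℝ :=
  (1 / S.mu x) * ∑' y, S.w x y * (u y - u x)

/-- `|∇u|²(x) = (1/(2μ(x))) Σ_{y ∼ x} w_{xy} (u(y) - u(x))²`. -/
noncomputable def gradSq (u : V → ℝ) (x : V) : ℝ :=
  (1 / (2 * S.mu x)) * ∑' y, S.w x y * (u y - u x) ^ 2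

/-- `∇u·∇v(x) = (1/(2μ(x))) Σ_{y ∼ x} w_{xy} (u(y) - u(x))(v(y) - v(x))`. -/
noncomputable def gradDot (u v : V → ℝ) (x : V) : ℝ :=
  (1 / (2 * S.mu x)) * ∑' y, S.w x y * (u y - u x) * (v y - v x)

/-- The `L^r` norm `‖u‖_r = (∫_V |u|^r dμ)^{1/r}` for `1 ≤ r < ∞`. -/
noncomputable def normLr (r : ℝ) (u : V → ℝ) : ℝ :=
  (S.integral fun x => |u x| ^ r) ^ (1 / r)

/-- The density `|Δu|² + a |∇u|² + V(x) u²` defining the norm of the space `E_i`. -/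
noncomputable def energyDensity (a : ℝ) (Vp : V → ℝ) (u : V → ℝ) (x : V) : ℝ :=
  (S.lap u x) ^ 2 + a * S.gradSq u x + Vp x * (u x) ^ 2

/-- Membership in the working space `E_i` (finiteness of the `E_i`-norm). -/
def memE (a : ℝ) (Vp : V → ℝ) (u : V → ℝ) : Prop :=
  Summable fun x => S.energyDensity a Vp u x * S.mu x

/-- The norm `‖u‖_{E_i} = (∫_V (|Δu|² + a_i |∇u|² + V_i(x)u²) dμ)^{1/2}`. -/
noncomputable def normE (a : ℝ) (Vp : V → ℝ) (u : V → ℝ) : ℝ :=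
  Real.sqrt (S.integral (S.energyDensity a Vp u))

/-- The inner product `(u,v)_{E_i} = ∫_V (Δu Δv + a_i ∇u·∇v + V_i(x) u v) dμ`. -/
noncomputable def innerE (a : ℝ) (Vp : V → ℝ) (u v : V → ℝ) : ℝ :=
  S.integral fun x => S.lap u x * S.lap v x + a * S.gradDot u v x + Vp x * u x * v x

/-- The energy functional `Φ` of the biharmonic–Kirchhoff system. -/
noncomputable def Phi (a₁ a₂ b₁ b₂ : ℝ) (V₁ V₂ : V → ℝ) (F : V → ℝ → ℝ → ℝ)
    (u v : V → ℝ) : ℝ :=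
  (1/2) * S.integral (S.energyDensity a₁ V₁ u) + (1/2) * S.integral (S.energyDensity a₂ V₂ v)
    + (b₁/4) * (S.integral (S.gradSq u)) ^ 2 + (b₂/4) * (S.integral (S.gradSq v)) ^ 2
    - S.integral fun x => F x (u x) (v x)

/-- The action `⟨Φ'(u,v), (φ₁,φ₂)⟩` of the derivative of `Φ`. -/
noncomputable def PhiDeriv (a₁ a₂ b₁ b₂ : ℝ) (V₁ V₂ : V → ℝ) (Fs Ft : V → ℝ → ℝ → ℝ)
    (u v φ₁ φ₂ : V → ℝ) : ℝ :=
  S.innerE a₁ V₁ u φ₁ + S.innerE a₂ V₂ v φ₂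
    + b₁ * S.integral (S.gradSq u) * S.integral (S.gradDot u φ₁)
    + b₂ * S.integral (S.gradSq v) * S.integral (S.gradDot v φ₂)
    - S.integral (fun x => Fs x (u x) (v x) * φ₁ x)
    - S.integral (fun x => Ft x (u x) (v x) * φ₂ x)

/-- `(u,v)` solves the biharmonic–Kirchhoff system (pointwise on `V`). -/
def IsSolution (a₁ a₂ b₁ b₂ : ℝ) (V₁ V₂ : V → ℝ) (Fs Ft : V → ℝ → ℝ → ℝ)
    (u v : V → ℝ) : Prop :=
  (∀ x, S.lap (S.lap u) x - (a₁ + b₁ * S.integral (S.gradSq u)) * S.lap u x + V₁ x * u x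
      = Fs x (u x) (v x)) ∧
  (∀ x, S.lap (S.lap v) x - (a₂ + b₂ * S.integral (S.gradSq v)) * S.lap v x + V₂ x * v x
      = Ft x (u x) (v x))

/-- Condition (V): `θᵢ = inf_V Vᵢ > 0` and `Vᵢ(x) → +∞` as `d(x,x₀) → ∞`. -/
def CondV (V₁ V₂ : V → ℝ) (θ₁ θ₂ : ℝ) : Prop :=
  IsGLB (Set.range V₁) θ₁ ∧ IsGLB (Set.range V₂) θ₂ ∧ 0 < θ₁ ∧ 0 < θ₂ ∧
    ∃ x₀ : V, ∀ M : ℝ, ∃ N : ℕ, ∀ x : V, N ≤ S.G.dist x₀ x → M ≤ V₁ x ∧ M ≤ V₂ x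

/-- Condition (F₀). -/
def CondF0 (F : V → ℝ → ℝ → ℝ) : Prop :=
  (∀ x, F x 0 0 = 0) ∧ ∀ x, ContDiff ℝ 1 (fun p : ℝ × ℝ => F x p.1 p.2)

/-- `Fs` and `Ft` are the partial derivatives of `F` in its last two arguments. -/
def IsPartialDerivs (F Fs Ft : V → ℝ → ℝ → ℝ) : Prop :=
  ∀ x s t, HasDerivAt (fun s' => F x s' t) (Fs x s t) s ∧
           HasDerivAt (fun t' => F x s t') (Ft x s t) t

/-- Condition (F₁). -/
def CondF1 (F Fs Ft : V → ℝ → ℝ → ℝ) (a : ℝ → ℝ) (b : V → ℝ) : Prop :=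
  ContinuousOn a (Set.Ici 0) ∧ (∀ r : ℝ, 0 ≤ r → 0 ≤ a r) ∧ (∀ x, 0 < b x) ∧
    Summable (fun x => b x * S.mu x) ∧
    ∀ x s t, |Fs x s t| ≤ a (Real.sqrt (s ^ 2 + t ^ 2)) * b x ∧
             |Ft x s t| ≤ a (Real.sqrt (s ^ 2 + t ^ 2)) * b x ∧
             |F x s t| ≤ a (Real.sqrt (s ^ 2 + t ^ 2)) * b x

/-- Condition (C₁): `lim_{r → 0⁺} a(r)/r² = h < ∞`. -/
def CondC1 (a : ℝ → ℝ) : Prop :=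
  ∃ h : ℝ, Tendsto (fun r => a r / r ^ 2) (nhdsWithin 0 (Set.Ioi 0)) (nhds h)

/-- `γ_{∞,i} = (μ_min · inf_V V_i)^{-1/2}`. -/
noncomputable def gammaInf (θ : ℝ) : ℝ := 1 / Real.sqrt (S.mumin * θ)

/-- Condition (C₂). -/
def CondC2 (a : ℝ → ℝ) (b : V → ℝ) (θ₁ θ₂ : ℝ) : Prop :=
  ∃ ρ : ℝ, 0 < ρ ∧
    0 < ρ ^ 2 / 4 - sSup (a '' Set.Icc 0 ((S.gammaInf θ₁ + S.gammaInf θ₂) * ρ)) * S.integral b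

/-- Condition (F₂): `F(x,s,t)/|(s,t)|⁴ → +∞` as `|(s,t)| → ∞`, uniformly in `x`. -/
def CondF2 (F : V → ℝ → ℝ → ℝ) : Prop :=
  ∀ M : ℝ, ∃ R : ℝ, ∀ x s t, R ≤ Real.sqrt (s ^ 2 + t ^ 2) → M * (s ^ 2 + t ^ 2) ^ 2 ≤ F x s t

/-- Condition (F₂)': `F(x,s,t)/|(s,t)|² → +∞` as `|(s,t)| → ∞`, uniformly in `x`. -/
def CondF2' (F : V → ℝ → ℝ → ℝ) : Prop :=
  ∀ M : ℝ, ∃ R : ℝ, ∀ x s t, R ≤ Real.sqrt (s ^ 2 + t ^ 2) → M * (s ^ 2 + t ^ 2) ≤ F x s t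

/-- Condition (F₃): `F ≥ 0` outside the ball of radius `r₀`. -/
def CondF3 (F : V → ℝ → ℝ → ℝ) (r₀ : ℝ) : Prop :=
  ∀ x s t, r₀ ≤ Real.sqrt (s ^ 2 + t ^ 2) → 0 ≤ F x s t

/-- `𝓕(x,s,t) = λ (s F_s + t F_t) - F` (with `λ = 1/4` resp. `1/2`). -/
noncomputable def curlyF (lam : ℝ) (F Fs Ft : V → ℝ → ℝ → ℝ) (x : V) (s t : ℝ) : ℝ :=
  lam * (s * Fs x s t + t * Ft x s t) - F x s t

/-- Condition (F₄) (with `λ = 1/4`); `k` is a real exponent and `^` is `Real.rpow`. -/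
def CondF4 (F Fs Ft : V → ℝ → ℝ → ℝ) (r₀ : ℝ) : Prop :=
  (∀ (x : V) (s t : ℝ), 0 ≤ curlyF (1/4) F Fs Ft x s t) ∧
  ∃ c : ℝ, 0 < c ∧ ∃ k : ℝ, 1 < k ∧ ∀ (x : V) (s t : ℝ), r₀ ≤ Real.sqrt (s ^ 2 + t ^ 2) →
    |F x s t| ^ k ≤ c * (s ^ 2 + t ^ 2) ^ k * curlyF (1/4) F Fs Ft x s t

/-- Condition (F₄)' (with `λ = 1/2`). -/
def CondF4' (F Fs Ft : V → ℝ → ℝ → ℝ) (r₀ : ℝ) : Prop :=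
  (∀ (x : V) (s t : ℝ), 0 ≤ curlyF (1/2) F Fs Ft x s t) ∧
  ∃ c : ℝ, 0 < c ∧ ∃ k : ℝ, 1 < k ∧ ∀ (x : V) (s t : ℝ), r₀ ≤ Real.sqrt (s ^ 2 + t ^ 2) →
    |F x s t| ^ k ≤ c * (s ^ 2 + t ^ 2) ^ k * curlyF (1/2) F Fs Ft x s t

/-- `γ_{2,i} = (inf_V V_i)^{-1/2}`. -/
noncomputable def gamma2 (θ : ℝ) : ℝ := 1 / Real.sqrt θ

/-- Condition (F₅) (`lb = 4`), resp. (F₅)' (`lb = 2`): there are `μ̄ > lb` and an admissible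
`σ` with `μ̄ F ≤ s F_s + t F_t + σ (s² + t²)`. -/
def CondF5 (lb : ℝ) (F Fs Ft : V → ℝ → ℝ → ℝ) (θ₁ θ₂ : ℝ) : Prop :=
  ∃ μb : ℝ, lb < μb ∧ ∃ σ : ℝ, 0 < σ ∧
    σ < (μb - 2) / (2 * max (gamma2 θ₁ ^ 2) (gamma2 θ₂ ^ 2)) ∧
    ∀ (x : V) (s t : ℝ), μb * F x s t ≤ s * Fs x s t + t * Ft x s t + σ * (s ^ 2 + t ^ 2)

/-- Condition (F₆): `F` is even in `(s,t)`. -/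
def CondF6 (F : V → ℝ → ℝ → ℝ) : Prop :=
  ∀ (x : V) (s t : ℝ), F x (-s) (-t) = F x s t

/-- A Cerami sequence for `Φ`: `Φ(uₙ,vₙ)` is bounded and
`(1 + ‖(uₙ,vₙ)‖)‖Φ'(uₙ,vₙ)‖_{E*} → 0`. -/
def CeramiSeq (a₁ a₂ b₁ b₂ : ℝ) (V₁ V₂ : V → ℝ) (F Fs Ft : V → ℝ → ℝ → ℝ)
    (u v : ℕ → V → ℝ) : Prop :=
  (∀ n, S.memE a₁ V₁ (u n) ∧ S.memE a₂ V₂ (v n)) ∧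
  (∃ C : ℝ, ∀ n, |S.Phi a₁ a₂ b₁ b₂ V₁ V₂ F (u n) (v n)| ≤ C) ∧
  ∃ ε : ℕ → ℝ, Tendsto ε atTop (nhds 0) ∧
    ∀ (n : ℕ) (φ₁ φ₂ : V → ℝ), S.memE a₁ V₁ φ₁ → S.memE a₂ V₂ φ₂ →
      S.normE a₁ V₁ φ₁ + S.normE a₂ V₂ φ₂ ≤ 1 →
      (1 + (S.normE a₁ V₁ (u n) + S.normE a₂ V₂ (v n))) *
        |S.PhiDeriv a₁ a₂ b₁ b₂ V₁ V₂ Fs Ft (u n) (v n) φ₁ φ₂| ≤ ε n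

end WeightedGraph

namespace WeightedGraph

lemma mu_pos {V : Type*} (S : WeightedGraph V) (x : V) : 0 < S.mu x :=
  S.mumin_pos.trans_le (S.mu_ge x)

lemma gradSq_nonneg {V : Type*} (S : WeightedGraph V) (u : V → ℝ) (x : V) :
    0 ≤ S.gradSq u x := by
  have hμ := S.mu_pos x
  refine mul_nonneg (by positivity) (tsum_nonneg fun y => mul_nonneg ?_ (sq_nonneg _))
  by_cases h : S.G.Adj x y
  · exact (S.w_pos x y h).le
  · exact (S.w_eq_zero x y h).ge

lemma gradDot_self {V : Type*} (S : WeightedGraph V) (u : V → ℝ) :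
    S.gradDot u u = S.gradSq u := by
  funext x
  simp only [gradDot, gradSq, sq, mul_assoc]

lemma innerE_self {V : Type*} (S : WeightedGraph V) (a : ℝ) (Vp u : V → ℝ) :
    S.innerE a Vp u u = S.integral (S.energyDensity a Vp u) := by
  unfold innerE
  congr 1
  funext x
  rw [gradDot_self, energyDensity]
  ring

lemma mul_sq_le_energyDensity {V : Type*} (S : WeightedGraph V) {a θ : ℝ} (ha : 0 ≤ a)
    {Vp : V → ℝ} (hVp : ∀ x, θ ≤ Vp x) (u : V → ℝ) (x : V) :
    θ * u x ^ 2 ≤ S.energyDensity a Vp u x := by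
  have h₁ := mul_nonneg ha (S.gradSq_nonneg u x)
  have h₂ := mul_le_mul_of_nonneg_right (hVp x) (sq_nonneg (u x))
  have h₃ := sq_nonneg (S.lap u x)
  unfold energyDensity
  linarith

lemma sq_mul_mu_le {V : Type*} (S : WeightedGraph V) {a θ : ℝ} (ha : 0 ≤ a) (hθ : 0 < θ)
    {Vp : V → ℝ} (hVp : ∀ x, θ ≤ Vp x) (u : V → ℝ) (x : V) :
    u x ^ 2 * S.mu x ≤ gamma2 θ ^ 2 * (S.energyDensity a Vp u x * S.mu x) := by
  have h := mul_le_mul_of_nonneg_right (S.mul_sq_le_energyDensity ha hVp u x) (S.mu_pos x).le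
  rw [gamma2, div_pow, Real.sq_sqrt hθ.le, one_pow, one_div, inv_mul_eq_div, le_div_iff₀ hθ]
  linarith

lemma memE.summable_sq {V : Type*} {S : WeightedGraph V} {a θ : ℝ} (ha : 0 ≤ a) (hθ : 0 < θ)
    {Vp : V → ℝ} (hVp : ∀ x, θ ≤ Vp x) {u : V → ℝ} (hu : S.memE a Vp u) :
    Summable fun x => u x ^ 2 * S.mu x :=
  Summable.of_nonneg_of_le (fun x => mul_nonneg (sq_nonneg _) (S.mu_pos x).le)
    (S.sq_mul_mu_le ha hθ hVp u) (Summable.mul_left _ hu)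

lemma memE.integral_sq_le {V : Type*} {S : WeightedGraph V} {a θ : ℝ} (ha : 0 ≤ a)
    (hθ : 0 < θ) {Vp : V → ℝ} (hVp : ∀ x, θ ≤ Vp x) {u : V → ℝ} (hu : S.memE a Vp u) :
    S.integral (fun x => u x ^ 2) ≤ gamma2 θ ^ 2 * S.integral (S.energyDensity a Vp u) := by
  unfold integral
  rw [← tsum_mul_left]
  exact (memE.summable_sq ha hθ hVp hu).tsum_le_tsum (S.sq_mul_mu_le ha hθ hVp u)
    (Summable.mul_left _ hu)

lemma integral_energyDensity_nonneg {V : Type*} (S : WeightedGraph V) {a θ : ℝ} (ha : 0 ≤ a)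
    (hθ : 0 ≤ θ) {Vp : V → ℝ} (hVp : ∀ x, θ ≤ Vp x) (u : V → ℝ) :
    0 ≤ S.integral (S.energyDensity a Vp u) :=
  tsum_nonneg fun x => mul_nonneg
    ((mul_nonneg hθ (sq_nonneg (u x))).trans (S.mul_sq_le_energyDensity ha hVp u x))
    (S.mu_pos x).le

lemma sq_le_of_summable {V : Type*} (S : WeightedGraph V) {u : V → ℝ}
    (hu : Summable fun x => u x ^ 2 * S.mu x) (x : V) :
    u x ^ 2 ≤ S.integral (fun x => u x ^ 2) / S.mumin := by
  rw [le_div_iff₀ S.mumin_pos]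
  exact (mul_le_mul_of_nonneg_left (S.mu_ge x) (sq_nonneg _)).trans
    (hu.le_tsum x fun y _ => mul_nonneg (sq_nonneg _) (S.mu_pos y).le)

/-- A function bounded along `(u, v)` by `a (|(u, v)|) * b`, with `u`, `v` square integrable and `b`
integrable, is integrable against any bounded factor. -/
lemma summable_of_le_growth {V : Type*} (S : WeightedGraph V) {a : ℝ → ℝ} {b u v f g : V → ℝ}
    (ha : ContinuousOn a (Set.Ici 0)) (hb : ∀ x, 0 < b x)
    (hbs : Summable fun x => b x * S.mu x)
    (hu : Summable fun x => u x ^ 2 * S.mu x) (hv : Summable fun x => v x ^ 2 * S.mu x)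
    (hf : ∀ x, |f x| ≤ a (Real.sqrt (u x ^ 2 + v x ^ 2)) * b x)
    {C : ℝ} (hg : ∀ x, |g x| ≤ C) :
    Summable fun x => f x * g x * S.mu x := by
  set R := Real.sqrt (S.integral (fun x => u x ^ 2) / S.mumin
    + S.integral (fun x => v x ^ 2) / S.mumin)
  obtain ⟨M, hM⟩ := (isCompact_Icc (a := 0) (b := R)).bddAbove_image
    (ha.mono Set.Icc_subset_Ici_self)
  refine Summable.of_norm_bounded (g := fun x => M * C * (b x * S.mu x))
    (hbs.mul_left _) fun x => ?_
  have haM : a (Real.sqrt (u x ^ 2 + v x ^ 2)) ≤ M :=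
    hM ⟨_, ⟨Real.sqrt_nonneg _, Real.sqrt_le_sqrt
      (add_le_add (S.sq_le_of_summable hu x) (S.sq_le_of_summable hv x))⟩, rfl⟩
  have hfM : |f x| ≤ M * b x := (hf x).trans (mul_le_mul_of_nonneg_right haM (hb x).le)
  rw [Real.norm_eq_abs, abs_mul, abs_mul, abs_of_pos (S.mu_pos x)]
  calc |f x| * |g x| * S.mu x ≤ M * b x * C * S.mu x :=
        mul_le_mul_of_nonneg_right (mul_le_mul hfM (hg x) (abs_nonneg _)
          ((abs_nonneg _).trans hfM)) (S.mu_pos x).le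
    _ = M * C * (b x * S.mu x) := by ring

lemma gamma2_pos {θ : ℝ} (hθ : 0 < θ) : 0 < gamma2 θ :=
  one_div_pos.2 (Real.sqrt_pos.2 hθ)

end WeightedGraph

open WeightedGraph

/-- Coercivity estimate (inequality (3.12)): under (V), (F₀), (F₁), (F₅), for every
`(u,v) ∈ E`, `Φ(u,v) - (1/μ̄)⟨Φ'(u,v),(u,v)⟩` dominates a positive multiple of
`‖u‖²_{E₁} + ‖v‖²_{E₂}`. -/
theorem coercivity_estimate
    {V : Type*} (S : WeightedGraph V)
    (a₁ a₂ b₁ b₂ : ℝ) (ha₁ : 0 < a₁) (ha₂ : 0 < a₂) (hb₁ : 0 ≤ b₁) (hb₂ : 0 ≤ b₂)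
    (V₁ V₂ : V → ℝ) (θ₁ θ₂ : ℝ) (hV : S.CondV V₁ V₂ θ₁ θ₂)
    (F Fs Ft : V → ℝ → ℝ → ℝ) (hFder : IsPartialDerivs F Fs Ft)
    (a : ℝ → ℝ) (b : V → ℝ)
    (hF0 : CondF0 F) (hF1 : S.CondF1 F Fs Ft a b)
    (μb σ : ℝ) (hμb : 4 < μb) (hσ0 : 0 < σ)
    (hσ : σ < (μb - 2) / (2 * max (gamma2 θ₁ ^ 2) (gamma2 θ₂ ^ 2)))
    (hF5 : ∀ (x : V) (s t : ℝ),
      μb * F x s t ≤ s * Fs x s t + t * Ft x s t + σ * (s ^ 2 + t ^ 2))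
    (u v : V → ℝ) (hu : S.memE a₁ V₁ u) (hv : S.memE a₂ V₂ v) :
    0 < (μb - 2) / (2 * μb) - σ / μb * max (gamma2 θ₁ ^ 2) (gamma2 θ₂ ^ 2) ∧
    ((μb - 2) / (2 * μb) - σ / μb * max (gamma2 θ₁ ^ 2) (gamma2 θ₂ ^ 2)) *
        (S.integral (S.energyDensity a₁ V₁ u) + S.integral (S.energyDensity a₂ V₂ v))
      ≤ S.Phi a₁ a₂ b₁ b₂ V₁ V₂ F u v
        - (1 / μb) * S.PhiDeriv a₁ a₂ b₁ b₂ V₁ V₂ Fs Ft u v u v := by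
  obtain ⟨hV₁, hV₂, hθ₁, hθ₂, -⟩ := hV
  have hV₁ : ∀ x, θ₁ ≤ V₁ x := fun x => hV₁.1 ⟨x, rfl⟩
  have hV₂ : ∀ x, θ₂ ≤ V₂ x := fun x => hV₂.1 ⟨x, rfl⟩
  obtain ⟨ha, -, hb, hbs, hF⟩ := hF1
  have hμ : 0 < μb := by linarith
  have hu2 := memE.summable_sq ha₁.le hθ₁ hV₁ hu
  have hv2 := memE.summable_sq ha₂.le hθ₂ hV₂ hv
  have hsF : Summable fun x => F x (u x) (v x) * S.mu x := by
    simpa using S.summable_of_le_growth (g := fun _ => 1) (C := 1) ha hb hbs hu2 hv2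
      (fun x => (hF x (u x) (v x)).2.2) (by simp)
  have hsFs : Summable fun x => Fs x (u x) (v x) * u x * S.mu x :=
    S.summable_of_le_growth ha hb hbs hu2 hv2 (fun x => (hF x (u x) (v x)).1)
      fun x => Real.abs_le_sqrt (S.sq_le_of_summable hu2 x)
  have hsFt : Summable fun x => Ft x (u x) (v x) * v x * S.mu x :=
    S.summable_of_le_growth ha hb hbs hu2 hv2 (fun x => (hF x (u x) (v x)).2.1)
      fun x => Real.abs_le_sqrt (S.sq_le_of_summable hv2 x)
  have hint : μb * S.integral (fun x => F x (u x) (v x)) ≤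
      S.integral (fun x => Fs x (u x) (v x) * u x) + S.integral (fun x => Ft x (u x) (v x) * v x)
        + σ * (S.integral (fun x => u x ^ 2) + S.integral (fun x => v x ^ 2)) := by
    unfold integral
    rw [← hu2.tsum_add hv2, ← tsum_mul_left, ← tsum_mul_left, ← hsFs.tsum_add hsFt,
      ← (hsFs.add hsFt).tsum_add ((hu2.add hv2).mul_left σ)]
    refine (hsF.mul_left μb).tsum_le_tsum (fun x => ?_)
      ((hsFs.add hsFt).add ((hu2.add hv2).mul_left σ))
    have := mul_le_mul_of_nonneg_right (hF5 x (u x) (v x)) (S.mu_pos x).le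
    linarith
  have hA₁ := S.integral_energyDensity_nonneg ha₁.le hθ₁.le hV₁ u
  have hA₂ := S.integral_energyDensity_nonneg ha₂.le hθ₂.le hV₂ v
  have hIu := (memE.integral_sq_le ha₁.le hθ₁ hV₁ hu).trans
    (mul_le_mul_of_nonneg_right (le_max_left (gamma2 θ₁ ^ 2) (gamma2 θ₂ ^ 2)) hA₁)
  have hIv := (memE.integral_sq_le ha₂.le hθ₂ hV₂ hv).trans
    (mul_le_mul_of_nonneg_right (le_max_right (gamma2 θ₁ ^ 2) (gamma2 θ₂ ^ 2)) hA₂)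
  have hK : 0 < max (gamma2 θ₁ ^ 2) (gamma2 θ₂ ^ 2) :=
    lt_max_of_lt_left (pow_pos (gamma2_pos hθ₁) 2)
  simp only [Phi, PhiDeriv, innerE_self, gradDot_self]
  set K := max (gamma2 θ₁ ^ 2) (gamma2 θ₂ ^ 2)
  set A₁ := S.integral (S.energyDensity a₁ V₁ u)
  set A₂ := S.integral (S.energyDensity a₂ V₂ v)
  set G₁ := S.integral (S.gradSq u)
  set G₂ := S.integral (S.gradSq v)
  set I := S.integral fun x => F x (u x) (v x)
  set Is := S.integral fun x => Fs x (u x) (v x) * u x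
  set It := S.integral fun x => Ft x (u x) (v x) * v x
  rw [lt_div_iff₀ (by positivity)] at hσ
  constructor
  · have : (μb - 2) / (2 * μb) - σ / μb * K = (μb - 2 - σ * (2 * K)) / (2 * μb) := by
      field_simp
    rw [this]
    exact div_pos (by linarith) (by positivity)
  · have hI : μb * I ≤ Is + It + σ * (K * A₁ + K * A₂) :=
      hint.trans (by gcongr)
    have hG : 0 ≤ (μb - 4) / 4 * (b₁ * G₁ ^ 2 + b₂ * G₂ ^ 2) :=
      mul_nonneg (by linarith) (by positivity)
    rw [← sub_nonneg]
    have : 0 ≤ ((Is + It + σ * (K * A₁ + K * A₂) - μb * I)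
        + (μb - 4) / 4 * (b₁ * G₁ ^ 2 + b₂ * G₂ ^ 2)) / μb :=
      div_nonneg (by linarith) hμ.le
    convert this using 1
    field_simp
    ring
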